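/- In the braid group B_N the mixed relation M3 holds: for all 1 ≤ i and i+1 < j ≤ N, σ_i⁻¹ a_{ij} σ_i = a_{ij} a_{i+1,j} a_{ij}⁻¹. -/

import Mathlib

open FreeGroup

namespace BraidPaper

/-- Relators for the Artin braid group on generators `σ_1, …, σ_n`
(so this presents the braid group `B_{n+1}`); the generator with index `k : Fin n`
represents `σ_{k+1}`. -/
def braidRels (n : ℕ) : Set (FreeGroup (Fin n)) :=
  {x | ∃ k l : Fin n, ((k : ℕ) + 2 ≤ (l : ℕ) ∨ (l : ℕ) + 2 ≤ (k : ℕ)) ∧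
      x = of k * of l * (of k)⁻¹ * (of l)⁻¹} ∪
  {x | ∃ k l : Fin n, (l : ℕ) = (k : ℕ) + 1 ∧
      x = of k * of l * of k * (of l)⁻¹ * (of k)⁻¹ * (of l)⁻¹}

/-- The braid group with `n` generators `σ_1, …, σ_n`, i.e. the Artin braid group
`B_{n+1}`.  Thus `B_N = BraidGroup (N-1)`. -/
abbrev BraidGroup (n : ℕ) : Type := PresentedGroup (braidRels n)

/-- The generator `σ_k` (1-based) of `BraidGroup n`, for `1 ≤ k ≤ n`. -/
def sgen (n k : ℕ) : BraidGroup n :=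
  if h : 1 ≤ k ∧ k ≤ n then PresentedGroup.of ⟨k - 1, by omega⟩ else 1

/-- The descending product `σ_{j-1} σ_{j-2} ⋯ σ_{i+1}`. -/
def dprod (n i j : ℕ) : BraidGroup n :=
  ((List.range (j - 1 - i)).map fun t => sgen n (j - 1 - t)).prod

/-- The pure braid generator
`a_{ij} = σ_{j-1} σ_{j-2} ⋯ σ_{i+1} σ_i² σ_{i+1}⁻¹ ⋯ σ_{j-2}⁻¹ σ_{j-1}⁻¹`. -/
def agen (n i j : ℕ) : BraidGroup n := dprod n i j * (sgen n i) ^ 2 * (dprod n i j)⁻¹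
/-- Generators whose indices differ by at least two commute. -/
theorem sgen_commute {n k l : ℕ} (hk : 1 ≤ k) (hkl : k + 2 ≤ l) (hl : l ≤ n) :
    Commute (sgen n k) (sgen n l) := by
  let a : Fin n := ⟨k - 1, by omega⟩
  let b : Fin n := ⟨l - 1, by omega⟩
  have h : PresentedGroup.mk (braidRels n) (of a * of b * (of a)⁻¹ * (of b)⁻¹) = 1 :=
    PresentedGroup.one_of_mem (Or.inl
      ⟨a, b, Or.inl (show k - 1 + 2 ≤ l - 1 by omega), rfl⟩)
  simp only [_root_.map_mul, _root_.map_inv] at h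
  rw [mul_inv_eq_one, mul_inv_eq_iff_eq_mul] at h
  rw [sgen, sgen, dif_pos ⟨hk, by omega⟩, dif_pos ⟨by omega, hl⟩]
  exact h

/-- Consecutive generators satisfy the braid relation. -/
theorem sgen_braid {n k : ℕ} (hk : 1 ≤ k) (hkn : k + 1 ≤ n) :
    sgen n k * sgen n (k + 1) * sgen n k = sgen n (k + 1) * sgen n k * sgen n (k + 1) := by
  let a : Fin n := ⟨k - 1, by omega⟩
  let b : Fin n := ⟨k + 1 - 1, by omega⟩
  have h : PresentedGroup.mk (braidRels n)
      (of a * of b * of a * (of b)⁻¹ * (of a)⁻¹ * (of b)⁻¹) = 1 :=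
    PresentedGroup.one_of_mem (Or.inr
      ⟨a, b, show k + 1 - 1 = k - 1 + 1 by omega, rfl⟩)
  simp only [_root_.map_mul, _root_.map_inv] at h
  rw [mul_inv_eq_one, mul_inv_eq_iff_eq_mul, mul_inv_eq_iff_eq_mul] at h
  rw [sgen, sgen, dif_pos ⟨hk, by omega⟩, dif_pos ⟨by omega, hkn⟩]
  exact h

theorem dprod_eq_mul_sgen {n i j : ℕ} (hij : i + 1 < j) :
    dprod n i j = dprod n (i + 1) j * sgen n (i + 1) := by
  obtain ⟨m, rfl⟩ : ∃ m, j = i + 2 + m := ⟨j - (i + 2), by omega⟩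
  simp only [dprod]
  rw [show i + 2 + m - 1 - i = m + 1 by omega, show i + 2 + m - 1 - (i + 1) = m by omega,
    List.range_succ, List.map_append, List.prod_append, List.map_singleton, List.prod_singleton,
    show i + 2 + m - 1 - m = i + 1 by omega]

theorem sgen_commute_dprod {n i j : ℕ} (hi : 1 ≤ i) (hj : j ≤ n + 1) :
    Commute (sgen n i) (dprod n (i + 1) j) := by
  refine Commute.list_prod_right _ _ fun x hx => ?_
  obtain ⟨t, ht, rfl⟩ := List.mem_map.1 hx
  rw [List.mem_range] at ht
  exact sgen_commute hi (by omega) (by omega)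

/-- The mixed relation for two elements satisfying the braid relation. -/
theorem inv_mul_conj_sq_mul_of_braid {G : Type*} [Group G] {x y : G}
    (h : x * y * x = y * x * y) :
    x⁻¹ * (y * x ^ 2 * y⁻¹) * x = (y * x ^ 2 * y⁻¹) * y ^ 2 * (y * x ^ 2 * y⁻¹)⁻¹ := by
  have hc : y⁻¹ * x * y = x * y * x⁻¹ := by
    calc y⁻¹ * x * y = y⁻¹ * (x * y * x) * x⁻¹ := by group
      _ = x * y * x⁻¹ := by rw [h]; group
  rw [eq_mul_inv_iff_mul_eq, mul_assoc, mul_assoc, inv_mul_eq_iff_eq_mul]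
  calc y * x ^ 2 * y⁻¹ * (x * (y * x ^ 2 * y⁻¹))
      = y * x ^ 2 * (y⁻¹ * x * y) * x ^ 2 * y⁻¹ := by group
    _ = y * x ^ 2 * (x * y * x) * y⁻¹ := by rw [hc]; group
    _ = y * x ^ 2 * (y * x * y) * y⁻¹ := by rw [h]
    _ = y * x * (x * y * x) := by simp only [pow_two, mul_assoc, mul_inv_cancel, mul_one]
    _ = y * x * (y * x * y) := by rw [h]
    _ = (y * x * y) * x * y := by simp only [mul_assoc]
    _ = (x * y * x) * x * y := by rw [h]
    _ = x * (y * x ^ 2 * y⁻¹ * y ^ 2) := by simp only [pow_two, mul_assoc, inv_mul_cancel_left]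

/-- Mixed relation M3: `σ_i⁻¹ a_{ij} σ_i = a_{ij} a_{i+1,j} a_{ij}⁻¹` for `1 ≤ i`, `i+1 < j ≤ N`. -/
theorem statement7 (N : ℕ) (hN : 2 ≤ N) (i j : ℕ)
    (hi : 1 ≤ i) (hij : i + 1 < j) (hj : j ≤ N) :
    (sgen (N - 1) i)⁻¹ * agen (N - 1) i j * sgen (N - 1) i =
      agen (N - 1) i j * agen (N - 1) (i + 1) j * (agen (N - 1) i j)⁻¹ := by
  have hx : (dprod (N - 1) (i + 1) j)⁻¹ * sgen (N - 1) i * dprod (N - 1) (i + 1) j =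
      sgen (N - 1) i := by
    rw [mul_assoc, (sgen_commute_dprod hi (by omega)).eq, inv_mul_cancel_left]
  have h := inv_mul_conj_sq_mul_of_braid (sgen_braid (n := N - 1) hi (by omega))
  unfold agen
  rw [dprod_eq_mul_sgen hij]
  generalize dprod (N - 1) (i + 1) j = d at *
  generalize sgen (N - 1) i = x at *
  generalize sgen (N - 1) (i + 1) = y at *
  calc x⁻¹ * (d * y * x ^ 2 * (d * y)⁻¹) * x
      = d * ((d⁻¹ * x * d)⁻¹ * (y * x ^ 2 * y⁻¹) * (d⁻¹ * x * d)) * d⁻¹ := by group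
    _ = _ := by rw [hx, h]; group

end BraidPaper
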